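/- arXiv:2604.20761 — 6 statements merged into one kernel-verified Lean document; each statement's English description precedes it below -/
import Mathlib

section
/- Let P and Q be probability measures on a measurable space that are mutually absolutely continuous, let ε* ≥ 0, and suppose that e^{−ε*} ≤ dP/dQ ≤ e^{ε*} holds Q-almost everywhere. Then for every α > 1, the Rényi divergence of order α satisfies D_α(P‖Q) ≤ (1/(α−1)) · log( e^{αε*}/(e^{ε*} + 1) + e^{ε*}·e^{−αε*}/(e^{ε*} + 1) ). -/
open MeasureTheory

/-- A convex function lies below its chord (form without division). -/
theorem ConvexOn.sub_mul_le_chord {f : ℝ → ℝ} {a b x : ℝ} (hf : ConvexOn ℝ (Set.Icc a b) f)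
    (hx : x ∈ Set.Icc a b) :
    (b - a) * f x ≤ (b - x) * f a + (x - a) * f b := by
  obtain ⟨hax, hxb⟩ := hx
  rcases (hax.trans hxb).eq_or_lt with hab | hab
  · obtain rfl : x = a := le_antisymm (hxb.trans hab.ge) hax
    subst hab
    simp
  · have hba : 0 < b - a := sub_pos.2 hab
    have h := hf.2 (Set.left_mem_Icc.2 hab.le) (Set.right_mem_Icc.2 hab.le)
      (div_nonneg (sub_nonneg.2 hxb) hba.le) (div_nonneg (sub_nonneg.2 hax) hba.le)
      (by field_simp; ring)
    have hpt : ((b - x) / (b - a)) • a + ((x - a) / (b - a)) • b = x := by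
      simp only [smul_eq_mul]
      field_simp
      ring
    rw [hpt] at h
    calc (b - a) * f x
        ≤ (b - a) * (((b - x) / (b - a)) • f a + ((x - a) / (b - a)) • f b) := by gcongr
      _ = (b - x) * f a + (x - a) * f b := by
        simp only [smul_eq_mul]
        field_simp

/-- The Edmundson–Madansky inequality: among random variables with values in `[a, b]` and a given
mean, the expectation of a convex function is largest for the one supported on `{a, b}`. -/
theorem ConvexOn.sub_mul_integral_le_chord {Ω : Type*} [MeasurableSpace Ω] {μ : Measure Ω}
    [IsProbabilityMeasure μ] {f : ℝ → ℝ} {a b : ℝ} {X : Ω → ℝ}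
    (hf : ConvexOn ℝ (Set.Icc a b) f) (hX : ∀ᵐ ω ∂μ, X ω ∈ Set.Icc a b)
    (hXi : Integrable X μ) (hfi : Integrable (fun ω => f (X ω)) μ) :
    (b - a) * ∫ ω, f (X ω) ∂μ ≤ (b - ∫ ω, X ω ∂μ) * f a + (∫ ω, X ω ∂μ - a) * f b := by
  have hl : Integrable (fun ω => (b - X ω) * f a) μ :=
    ((integrable_const b).sub hXi).mul_const _
  have hr : Integrable (fun ω => (X ω - a) * f b) μ :=
    (hXi.sub (integrable_const a)).mul_const _
  calc (b - a) * ∫ ω, f (X ω) ∂μ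
      = ∫ ω, (b - a) * f (X ω) ∂μ := (integral_const_mul _ _).symm
    _ ≤ ∫ ω, ((b - X ω) * f a + (X ω - a) * f b) ∂μ :=
        integral_mono_ae (hfi.const_mul _) (hl.add hr)
          (hX.mono fun ω hω => hf.sub_mul_le_chord hω)
    _ = (b - ∫ ω, X ω ∂μ) * f a + (∫ ω, X ω ∂μ - a) * f b := by
        rw [integral_add hl hr, integral_mul_const, integral_mul_const,
          integral_sub (integrable_const b) hXi, integral_sub hXi (integrable_const a)]
        simp

/-- A random variable with mean one and values in `[e^{-ε}, e^ε]` has `α`-th moment at most that of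
the two-point variable supported on the endpoints. -/
theorem integral_rpow_le_of_mem_Icc_exp {Ω : Type*} [MeasurableSpace Ω] {μ : Measure Ω}
    [IsProbabilityMeasure μ] {X : Ω → ℝ} {ε α : ℝ} (hε : 0 ≤ ε) (hα : 1 ≤ α)
    (hX : ∀ᵐ ω ∂μ, X ω ∈ Set.Icc (Real.exp (-ε)) (Real.exp ε))
    (hXi : Integrable X μ) (hXα : Integrable (fun ω => X ω ^ α) μ) (hmean : ∫ ω, X ω ∂μ = 1) :
    ∫ ω, X ω ^ α ∂μ ≤ Real.exp (α * ε) / (Real.exp ε + 1) +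
      Real.exp ε * Real.exp (-α * ε) / (Real.exp ε + 1) := by
  rcases hε.eq_or_lt with rfl | hpos
  · have h1 : ∀ᵐ ω ∂μ, X ω ^ α = 1 := hX.mono fun ω hω => by
      have : X ω = 1 := by simpa using hω
      rw [this, Real.one_rpow]
    rw [integral_congr_ae h1]
    norm_num
  · have hconv : ConvexOn ℝ (Set.Icc (Real.exp (-ε)) (Real.exp ε)) fun x => x ^ α :=
      (convexOn_rpow hα).subset
        (fun x hx => (Real.exp_pos _).le.trans hx.1) (convex_Icc _ _)
    have h := hconv.sub_mul_integral_le_chord hX hXi hXα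
    rw [hmean, ← Real.exp_mul, ← Real.exp_mul, show -ε * α = -α * ε by ring, mul_comm ε α] at h
    have hlt : 0 < Real.exp ε - Real.exp (-ε) :=
      sub_pos.2 (Real.exp_lt_exp.2 (by linarith))
    refine le_of_mul_le_mul_left (h.trans_eq ?_) hlt
    rw [Real.exp_neg]
    have := Real.exp_pos ε
    field_simp
    ring

/-- Sharp DP-to-RDP conversion: if `P` and `Q` are mutually absolutely
continuous probability measures whose likelihood ratio `dP/dQ` lies in
`[e^{−ε*}, e^{ε*}]` `Q`-a.e., then for every `α > 1` the Rényi divergence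
`D_α(P‖Q) = (1/(α−1)) log ∫ (dP/dQ)^α dQ` is bounded by
`(1/(α−1)) log( e^{αε*}/(e^{ε*}+1) + e^{ε*} e^{−αε*}/(e^{ε*}+1) )`. -/
theorem dp_to_rdp_conversion
    {Ω : Type*} [MeasurableSpace Ω] (P Q : Measure Ω)
    [IsProbabilityMeasure P] [IsProbabilityMeasure Q]
    (hPQ : P ≪ Q) (hQP : Q ≪ P) (ε' : ℝ) (hε' : 0 ≤ ε')
    (hbound : ∀ᵐ ω ∂Q, Real.exp (-ε') ≤ (P.rnDeriv Q ω).toReal ∧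
      (P.rnDeriv Q ω).toReal ≤ Real.exp ε')
    (α : ℝ) (hα : 1 < α) :
    (α - 1)⁻¹ * Real.log (∫ ω, ((P.rnDeriv Q ω).toReal) ^ α ∂Q)
      ≤ (α - 1)⁻¹ * Real.log
          (Real.exp (α * ε') / (Real.exp ε' + 1) +
            Real.exp ε' * Real.exp (-α * ε') / (Real.exp ε' + 1)) := by
  have hmeas : Measurable fun ω => (P.rnDeriv Q ω).toReal :=
    (Measure.measurable_rnDeriv P Q).ennreal_toReal
  have hXα : Integrable (fun ω => (P.rnDeriv Q ω).toReal ^ α) Q := by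
    refine Integrable.of_bound (hmeas.pow_const α).aestronglyMeasurable (Real.exp ε' ^ α)
      (hbound.mono fun ω hω => ?_)
    rw [Real.norm_of_nonneg (by positivity)]
    exact Real.rpow_le_rpow ENNReal.toReal_nonneg hω.2 (by linarith)
  have hmean : ∫ ω, (P.rnDeriv Q ω).toReal ∂Q = 1 := by
    rw [Measure.integral_toReal_rnDeriv hPQ]
    simp
  have hpos : 0 < ∫ ω, (P.rnDeriv Q ω).toReal ^ α ∂Q := by
    refine (Real.rpow_pos_of_pos (Real.exp_pos (-ε')) α).trans_le ?_
    calc Real.exp (-ε') ^ α = ∫ _, Real.exp (-ε') ^ α ∂Q := by simp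
      _ ≤ _ := integral_mono_ae (integrable_const _) hXα (hbound.mono fun ω hω =>
          Real.rpow_le_rpow (Real.exp_pos _).le hω.1 (by linarith))
  refine mul_le_mul_of_nonneg_left (Real.log_le_log hpos ?_) (inv_nonneg.2 (by linarith))
  exact integral_rpow_le_of_mem_Icc_exp hε' hα.le hbound Measure.integrable_toReal_rnDeriv hXα hmean
end

section
/- Let E be a real inner product space, S ⊆ E a convex set, and F, G : E → ℝ differentiable functions such that F is k-strongly convex on S for some k > 0 and G is convex on S. Suppose y_F ∈ S minimizes F over S, y_G ∈ S minimizes G over S, and ‖∇F(y_G) − ∇G(y_G)‖ ≤ η. Then ‖y_F − y_G‖ ≤ η/k. -/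
/-- First-order lower bound for strongly convex functions: the graph lies above each tangent
hyperplane by at least a quadratic term. -/
theorem StrongConvexOn.add_fderiv_add_sq_le {E : Type*} [NormedAddCommGroup E] [NormedSpace ℝ E]
    {S : Set E} {m : ℝ} {f : E → ℝ} {f' : E →L[ℝ] ℝ} {x y : E} (hf : StrongConvexOn S m f)
    (hf' : HasFDerivAt f f' x) (hx : x ∈ S) (hy : y ∈ S) :
    f x + f' (y - x) + m / 2 * ‖y - x‖ ^ 2 ≤ f y := by
  let h : ℝ → ℝ := fun t ↦
    f x + t * (f y - f x) - t * (1 - t) * (m / 2 * ‖y - x‖ ^ 2) - f (x + t • (y - x))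
  have hmin : IsMinOn h (Set.Icc 0 1) 0 := by
    intro t ht
    have hconv := hf.2 hx hy (sub_nonneg.2 ht.2) ht.1 (sub_add_cancel 1 t)
    have hpt : (1 - t) • x + t • y = x + t • (y - x) := by module
    rw [hpt, norm_sub_rev x y] at hconv
    simp only [smul_eq_mul] at hconv
    simp only [Set.mem_ofPred_eq, h, zero_smul, add_zero]
    linarith
  have hderiv : HasDerivAt h ((f y - f x) - m / 2 * ‖y - x‖ ^ 2 - f' (y - x)) 0 := by
    have hline : HasDerivAt (fun t : ℝ ↦ x + t • (y - x)) (y - x) 0 := by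
      simpa using ((hasDerivAt_id (0 : ℝ)).smul_const (y - x)).const_add x
    have hcomp : HasDerivAt (fun t : ℝ ↦ f (x + t • (y - x))) (f' (y - x)) 0 :=
      HasFDerivAt.comp_hasDerivAt (0 : ℝ) (by simpa using hf') hline
    have hid := hasDerivAt_id (0 : ℝ)
    have hquad := (hid.mul (hid.const_sub 1)).mul_const (m / 2 * ‖y - x‖ ^ 2)
    refine ((((hid.mul_const (f y - f x)).const_add (f x)).sub hquad).sub hcomp).congr_deriv ?_
    simp
  have hcone : (1 : ℝ) ∈ posTangentConeAt (Set.Icc (0 : ℝ) 1) 0 := by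
    simpa using sub_mem_posTangentConeAt_of_segment_subset
      (segment_eq_Icc (zero_le_one' ℝ)).subset
  have hnonneg := hmin.localize.hasFDerivWithinAt_nonneg
    hderiv.hasFDerivAt.hasFDerivWithinAt hcone
  simp only [ContinuousLinearMap.toSpanSingleton_apply, one_smul] at hnonneg
  linarith

/-- First-order optimality condition for a minimizer over a convex set. -/
theorem IsMinOn.fderiv_sub_nonneg {E : Type*} [NormedAddCommGroup E] [NormedSpace ℝ E]
    {S : Set E} {f : E → ℝ} {f' : E →L[ℝ] ℝ} {x y : E} (hmin : IsMinOn f S x)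
    (hf' : HasFDerivAt f f' x) (hS : Convex ℝ S) (hx : x ∈ S) (hy : y ∈ S) :
    0 ≤ f' (y - x) :=
  hmin.localize.hasFDerivWithinAt_nonneg hf'.hasFDerivWithinAt
    (sub_mem_posTangentConeAt_of_segment_subset (hS.segment_subset hx hy))

/-- Stability of minimizers of strongly convex functions: if `F` is
`k`-strongly convex on a convex set `S`, `G` is convex on `S`, `y_F` minimizes
`F` over `S`, `y_G` minimizes `G` over `S`, and the differentials of `F` and
`G` at `y_G` differ in norm by at most `η`, then `‖y_F − y_G‖ ≤ η/k`. -/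
theorem strong_convexity_minimizer_stability
    {E : Type*} [NormedAddCommGroup E] [InnerProductSpace ℝ E]
    (S : Set E) (F G : E → ℝ) (k η : ℝ) (hk : 0 < k)
    (hF : Differentiable ℝ F) (hG : Differentiable ℝ G)
    (hFsc : StrongConvexOn S k F) (hGc : ConvexOn ℝ S G)
    (yF yG : E) (hyF : yF ∈ S) (hyG : yG ∈ S)
    (hminF : ∀ z ∈ S, F yF ≤ F z) (hminG : ∀ z ∈ S, G yG ≤ G z)
    (hη : ‖fderiv ℝ F yG - fderiv ℝ G yG‖ ≤ η) :
    ‖yF - yG‖ ≤ η / k := by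
  have hFG := hFsc.add_fderiv_add_sq_le (hF yG).hasFDerivAt hyG hyF
  have hGF := hFsc.add_fderiv_add_sq_le (hF yF).hasFDerivAt hyF hyG
  have hF0 := IsMinOn.fderiv_sub_nonneg hminF (hF yF).hasFDerivAt hFsc.1 hyF hyG
  have hG0 := IsMinOn.fderiv_sub_nonneg hminG (hG yG).hasFDerivAt hGc.1 hyG hyF
  have hdiff := (neg_le_abs _).trans
    ((fderiv ℝ F yG - fderiv ℝ G yG).le_of_opNorm_le hη (yF - yG))
  rw [sub_apply] at hdiff
  rw [norm_sub_rev yG yF] at hGF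
  rw [le_div_iff₀ hk]
  rcases (norm_nonneg (yF - yG)).eq_or_lt with h0 | hpos
  · rw [← h0, zero_mul]
    exact (norm_nonneg _).trans hη
  · refine le_of_mul_le_mul_right ?_ hpos
    linarith
end

section
/- Let E be a real inner product space, let o, y ∈ E with ‖y − o‖ ≤ r for some r > 0, and let p ∈ (1, 2]. Then the function f(u) = (1/p)‖u − y‖^p is k-strongly convex on the closed ball B̄(o, r) with k = (p − 1)(2r)^{p−2}. -/
lemma hasDerivAt_rpow_sub_sq {p k s : ℝ} (hp : p ≠ 0) (hs : s ≠ 0) :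
    HasDerivAt (fun s : ℝ => (1 / p) * s ^ p - k / 2 * s ^ 2) (s ^ (p - 1) - k * s) s := by
  have h := ((Real.hasDerivAt_rpow_const (p := p) (Or.inl hs)).const_mul (1 / p)).sub
    ((hasDerivAt_pow 2 s).const_mul (k / 2))
  refine h.congr_deriv ?_
  field_simp
  norm_num
  ring

/-- The second derivative `(p - 1) * s ^ (p - 2)` of `s ^ p / p` is at least its value at the right
endpoint `R`, so subtracting the corresponding quadratic preserves convexity on `[0, R]`. -/
lemma convexOn_rpow_sub_sq {p R : ℝ} (hp1 : 1 < p) (hp2 : p ≤ 2) :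
    ConvexOn ℝ (Set.Icc 0 R)
      (fun s : ℝ => (1 / p) * s ^ p - (p - 1) * R ^ (p - 2) / 2 * s ^ 2) := by
  refine convexOn_of_hasDerivWithinAt2_nonneg (convex_Icc 0 R)
    (f' := fun s => s ^ (p - 1) - (p - 1) * R ^ (p - 2) * s)
    (f'' := fun s => (p - 1) * s ^ (p - 2) - (p - 1) * R ^ (p - 2)) ?_ ?_ ?_ ?_
  · have : Continuous fun s : ℝ => s ^ p := Real.continuous_rpow_const (by linarith)
    fun_prop
  · intro s hs
    rw [interior_Icc] at hs
    exact (hasDerivAt_rpow_sub_sq (by linarith) hs.1.ne').hasDerivWithinAt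
  · intro s hs
    rw [interior_Icc] at hs
    have h := (Real.hasDerivAt_rpow_const (p := p - 1) (Or.inl hs.1.ne')).sub
      ((hasDerivAt_id s).const_mul ((p - 1) * R ^ (p - 2)))
    refine (h.congr_deriv ?_).hasDerivWithinAt
    rw [show p - 1 - 1 = p - 2 by ring, mul_one]
  · intro s hs
    rw [interior_Icc] at hs
    have h : R ^ (p - 2) ≤ s ^ (p - 2) :=
      Real.rpow_le_rpow_of_nonpos hs.1 hs.2.le (by linarith)
    exact sub_nonneg.2 (mul_le_mul_of_nonneg_left h (by linarith))

lemma monotoneOn_rpow_sub_sq {p R : ℝ} (hp1 : 1 < p) (hp2 : p ≤ 2) :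
    MonotoneOn (fun s : ℝ => (1 / p) * s ^ p - (p - 1) * R ^ (p - 2) / 2 * s ^ 2)
      (Set.Icc 0 R) := by
  refine monotoneOn_of_hasDerivWithinAt_nonneg (convex_Icc 0 R)
    (f' := fun s => s ^ (p - 1) - (p - 1) * R ^ (p - 2) * s) ?_ ?_ ?_
  · have : Continuous fun s : ℝ => s ^ p := Real.continuous_rpow_const (by linarith)
    fun_prop
  · intro s hs
    rw [interior_Icc] at hs
    exact (hasDerivAt_rpow_sub_sq (by linarith) hs.1.ne').hasDerivWithinAt
  · intro s hs
    rw [interior_Icc] at hs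
    have h : R ^ (p - 2) ≤ s ^ (p - 2) :=
      Real.rpow_le_rpow_of_nonpos hs.1 hs.2.le (by linarith)
    have hR : 0 ≤ R ^ (p - 2) := Real.rpow_nonneg (hs.1.trans hs.2).le _
    have hs' : s ^ (p - 1) = s ^ (p - 2) * s := by
      rw [← Real.rpow_add_one hs.1.ne']
      ring_nf
    rw [hs', ← sub_mul]
    exact mul_nonneg (by nlinarith) hs.1.le

lemma strongConvexOn_closedBall_zero_norm_rpow
    {E : Type*} [NormedAddCommGroup E] [InnerProductSpace ℝ E]
    {p R : ℝ} (hp1 : 1 < p) (hp2 : p ≤ 2) :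
    StrongConvexOn (Metric.closedBall (0 : E) R) ((p - 1) * R ^ (p - 2))
      (fun u => (1 / p) * ‖u‖ ^ p) := by
  rw [strongConvexOn_iff_convex]
  have hball : Convex ℝ (Metric.closedBall (0 : E) R) := convex_closedBall 0 R
  have hnorm : ∀ {v : E}, v ∈ Metric.closedBall (0 : E) R → ‖v‖ ∈ Set.Icc 0 R :=
    fun hv => ⟨norm_nonneg _, mem_closedBall_zero_iff.1 hv⟩
  refine ⟨hball, fun x hx z hz a b ha hb hab => ?_⟩
  have hle : ‖a • x + b • z‖ ≤ a • ‖x‖ + b • ‖z‖ :=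
    (convexOn_univ_norm (E := E)).2 (Set.mem_univ x) (Set.mem_univ z) ha hb hab
  exact (monotoneOn_rpow_sub_sq hp1 hp2 (hnorm (hball hx hz ha hb hab))
    (convex_Icc 0 R (hnorm hx) (hnorm hz) ha hb hab) hle).trans
    ((convexOn_rpow_sub_sq hp1 hp2).2 (hnorm hx) (hnorm hz) ha hb hab)

/-- Strong convexity of the `p`-th power distance (flat case of Proposition
4.6): for `p ∈ (1, 2]` and `‖y − o‖ ≤ r`, the function `u ↦ (1/p)‖u − y‖^p` is
`k`-strongly convex on the closed ball `B̄(o, r)` with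
`k = (p − 1)(2r)^{p−2}`. -/
theorem pow_dist_strongConvexOn
    {E : Type*} [NormedAddCommGroup E] [InnerProductSpace ℝ E]
    (o y : E) (r p : ℝ) (hr : 0 < r) (hy : ‖y - o‖ ≤ r)
    (hp1 : 1 < p) (hp2 : p ≤ 2) :
    StrongConvexOn (Metric.closedBall o r) ((p - 1) * (2 * r) ^ (p - 2))
      (fun u => (1 / p) * ‖u - y‖ ^ p) := by
  have hmem : ∀ {u : E}, u ∈ Metric.closedBall o r → u - y ∈ Metric.closedBall (0 : E) (2 * r) := by
    intro u hu
    rw [mem_closedBall_iff_norm] at hu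
    rw [mem_closedBall_zero_iff]
    linarith [norm_sub_le_norm_sub_add_norm_sub u o y, norm_sub_rev o y]
  refine ⟨convex_closedBall o r, fun x hx z hz a b ha hb hab => ?_⟩
  have h := (strongConvexOn_closedBall_zero_norm_rpow hp1 hp2).2 (hmem hx) (hmem hz) ha hb hab
  have hcomb : a • (x - y) + b • (z - y) = a • x + b • z - y := by
    rw [smul_sub, smul_sub, sub_add_sub_comm, ← add_smul, hab, one_smul]
  rwa [hcomb, sub_sub_sub_cancel_right] at h
end

section
/- Let m ≥ 1, p > 1, r > 0, o ∈ ℝ^m, and let D = (x_1, …, x_n) and D′ = (x_1, …, x_{n−1}, x′_n) be two datasets of n points in the closed ball B̄(o, r) differing only in the last entry. Define F_D(y) = (1/(np)) Σ_{i=1}^n ‖y − x_i‖^p. Then F_D and F_{D′} are differentiable, the gradient of y ↦ (1/p)‖y − x‖^p is ‖y − x‖^{p−2}(y − x) (interpreted as 0 at y = x), and for every y ∈ B̄(o, r), ‖∇F_D(y) − ∇F_{D′}(y)‖ ≤ 2(2r)^{p−1}/n. -/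
open MeasureTheory

/-- The empirical Fréchet `p`-functional of a dataset `x = (x_1, …, x_n)` in
`ℝ^m`: `F_D(y) = (1/(np)) Σᵢ ‖y − xᵢ‖^p`. -/
noncomputable def frechetFun {m n : ℕ} (p : ℝ)
    (x : Fin n → EuclideanSpace ℝ (Fin m)) (y : EuclideanSpace ℝ (Fin m)) : ℝ :=
  (1 / (n * p)) * ∑ i : Fin n, ‖y - x i‖ ^ p

section NormPow

variable {E : Type*} [NormedAddCommGroup E] [InnerProductSpace ℝ E]

theorem hasGradientAt_norm_sub_rpow_div [CompleteSpace E] {p : ℝ} (hp : 1 < p) (c y : E) :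
    HasGradientAt (fun u => (1 / p) * ‖u - c‖ ^ p) (‖y - c‖ ^ (p - 2) • (y - c)) y := by
  rw [hasGradientAt_iff_hasFDerivAt]
  have h := ((hasFDerivAt_norm_rpow (y - c) hp).comp y
    ((hasFDerivAt_id y).sub_const c)).const_mul (1 / p)
  refine h.congr_fderiv ?_
  ext v
  have hp0 : p ≠ 0 := by positivity
  simp
  field_simp

theorem norm_rpow_sub_two_smul_self {p : ℝ} (hp : 1 < p) (v : E) :
    ‖‖v‖ ^ (p - 2) • v‖ = ‖v‖ ^ (p - 1) := by
  rcases eq_or_ne v 0 with rfl | hv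
  · simp [Real.zero_rpow (sub_pos.2 hp).ne']
  · rw [norm_smul, Real.norm_of_nonneg (by positivity),
      ← Real.rpow_add_one (norm_ne_zero_iff.2 hv)]
    congr 1
    ring

theorem norm_rpow_sub_two_smul_sub_le {p r : ℝ} (hp : 1 < p) {o a b : E}
    (ha : a ∈ Metric.closedBall o r) (hb : b ∈ Metric.closedBall o r) :
    ‖‖a - b‖ ^ (p - 2) • (a - b)‖ ≤ (2 * r) ^ (p - 1) := by
  rw [norm_rpow_sub_two_smul_self hp]
  refine Real.rpow_le_rpow (norm_nonneg _) ?_ (sub_nonneg.2 hp.le)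
  rw [← dist_eq_norm, two_mul]
  exact (dist_triangle_right a b o).trans (add_le_add ha hb)

end NormPow

theorem hasGradientAt_frechetFun {m n : ℕ} {p : ℝ} (hp : 1 < p)
    (x : Fin n → EuclideanSpace ℝ (Fin m)) (y : EuclideanSpace ℝ (Fin m)) :
    HasGradientAt (frechetFun p x)
      ((1 / (n : ℝ)) • ∑ i, ‖y - x i‖ ^ (p - 2) • (y - x i)) y := by
  have hF : frechetFun p x = fun u => (1 / (n : ℝ)) * ∑ i, (1 / p) * ‖u - x i‖ ^ p := by
    funext u
    rw [frechetFun, ← Finset.mul_sum, ← mul_assoc, one_div_mul_one_div]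
  rw [hF, hasGradientAt_iff_hasFDerivAt, map_smul, map_sum]
  exact (HasFDerivAt.fun_sum fun i _ =>
    (hasGradientAt_norm_sub_rpow_div hp (x i) y).hasFDerivAt).const_mul _

/-- Gradient-difference bound for the empirical Fréchet `p`-functional of two
datasets in `B̄(o, r)` differing only in the last entry: the functionals are
differentiable, the gradient of `y ↦ (1/p)‖y − c‖^p` is `‖y − c‖^{p−2}(y − c)`
(interpreted as `0` at `y = c`), and the gradients of the two functionals
differ by at most `2(2r)^{p−1}/n` on `B̄(o, r)`. -/
theorem frechetFun_gradient_difference_bound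
    (m n : ℕ) (hm : 1 ≤ m) (hn : 0 < n) (p r : ℝ) (hp : 1 < p) (hr : 0 < r)
    (o : EuclideanSpace ℝ (Fin m)) (x x' : Fin n → EuclideanSpace ℝ (Fin m))
    (hx : ∀ i, x i ∈ Metric.closedBall o r)
    (hx' : ∀ i, x' i ∈ Metric.closedBall o r)
    (hadj : ∀ i : Fin n, (i : ℕ) + 1 < n → x i = x' i) :
    Differentiable ℝ (frechetFun p x) ∧ Differentiable ℝ (frechetFun p x') ∧
    (∀ c y : EuclideanSpace ℝ (Fin m),
      gradient (fun u => (1 / p) * ‖u - c‖ ^ p) y = ‖y - c‖ ^ (p - 2) • (y - c)) ∧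
    ∀ y ∈ Metric.closedBall o r,
      ‖gradient (frechetFun p x) y - gradient (frechetFun p x') y‖
        ≤ 2 * (2 * r) ^ (p - 1) / n := by
  refine ⟨fun y => (hasGradientAt_frechetFun hp x y).differentiableAt,
    fun y => (hasGradientAt_frechetFun hp x' y).differentiableAt,
    fun c y => (hasGradientAt_norm_sub_rpow_div hp c y).gradient, fun y hy => ?_⟩
  rw [(hasGradientAt_frechetFun hp x y).gradient, (hasGradientAt_frechetFun hp x' y).gradient,
    ← smul_sub, ← Finset.sum_sub_distrib,
    Finset.sum_eq_single (⟨n - 1, by lia⟩ : Fin n), norm_smul,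
    Real.norm_of_nonneg (by positivity), one_div_mul_eq_div]
  · gcongr
    rw [two_mul]
    exact (norm_sub_le _ _).trans (add_le_add (norm_rpow_sub_two_smul_sub_le hp hy (hx _))
      (norm_rpow_sub_two_smul_sub_le hp hy (hx' _)))
  · intro i _ hi
    have hlt : (i : ℕ) + 1 < n := by
      have hne : (i : ℕ) ≠ n - 1 := fun h => hi (Fin.ext h)
      lia
    rw [hadj i hlt, sub_self]
  · simp
end

section
/- Let m ≥ 1, p ∈ (1, 2], r > 0, o ∈ ℝ^m, and let D and D′ be adjacent datasets of n points in the closed ball B̄(o, r) (differing in at most one entry). Let μ_p(D) and μ_p(D′) be the unique minimizers of the empirical Fréchet p-functionals F_D and F_{D′} over B̄(o, r). Then ‖μ_p(D) − μ_p(D′)‖ ≤ (2r)^{p−1} / ( n·(4r)^{p−2}·(p − 1) ). -/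
open scoped RealInnerProductSpace

section PowerMap

variable {E : Type*} [NormedAddCommGroup E] [InnerProductSpace ℝ E]

/-- Secant bound for the concave power `t ↦ t ^ q`, `q ∈ (0, 1]`. -/
lemma mul_sub_le_rpow_sub_rpow {q s t : ℝ} (hq0 : 0 < q) (hq1 : q ≤ 1) (hs : 0 < s) (ht : 0 ≤ t) :
    q * s ^ (q - 1) * (s - t) ≤ s ^ q - t ^ q := by
  have h := rpow_one_add_le_one_add_mul_self (s := t / s - 1)
    (by have := div_nonneg ht hs.le; linarith) hq0.le hq1
  rw [add_sub_cancel, Real.div_rpow ht hs.le] at h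
  have hsq : 0 < s ^ q := Real.rpow_pos_of_pos hs q
  rw [div_le_iff₀ hsq] at h
  rw [Real.rpow_sub_one hs.ne']
  have e : (1 + q * (t / s - 1)) * s ^ q = s ^ q - q * (s ^ q / s) * (s - t) := by
    field_simp
    ring
  linarith

/-- The gradient of `‖·‖ ^ p / p`, `p ∈ (1, 2]`, is strongly monotone on the ball of radius `R`. -/
lemma mul_norm_sub_sq_le_inner_rpow_smul_sub {p R : ℝ} (hp1 : 1 < p) (hp2 : p ≤ 2)
    {u v : E} (hu : ‖u‖ ≤ R) (hv : ‖v‖ ≤ R) :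
    (p - 1) * R ^ (p - 2) * ‖u - v‖ ^ 2
      ≤ ⟪‖u‖ ^ (p - 2) • u - ‖v‖ ^ (p - 2) • v, u - v⟫ := by
  have key : ∀ w : E, w ≠ 0 → ‖w‖ ≤ R → (p - 1) * R ^ (p - 2) ≤ ‖w‖ ^ (p - 2) := by
    intro w hw hwR
    have hw0 : 0 < ‖w‖ := norm_pos_iff.2 hw
    have h1 : R ^ (p - 2) ≤ ‖w‖ ^ (p - 2) :=
      Real.rpow_le_rpow_of_nonpos hw0 hwR (by linarith)
    have h0 : 0 < R ^ (p - 2) := Real.rpow_pos_of_pos (hw0.trans_le hwR) _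
    nlinarith
  wlog hvu : ‖v‖ ≤ ‖u‖ generalizing u v
  · have h := this hv hu (le_of_not_ge hvu)
    rw [norm_sub_rev, ← neg_sub (‖u‖ ^ (p - 2) • u), ← neg_sub u v, inner_neg_neg] at h
    exact h
  by_cases hu0 : u = 0
  · have hv0 : v = 0 := by simpa [hu0] using hvu
    simp [hu0, hv0]
  by_cases hv0 : v = 0
  · subst hv0
    simp only [sub_zero, smul_zero, real_inner_smul_left, real_inner_self_eq_norm_sq]
    exact mul_le_mul_of_nonneg_right (key u hu0 hu) (sq_nonneg _)
  have hA := key u hu0 hu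
  have hB := key v hv0 hv
  have hs : 0 < ‖u‖ := norm_pos_iff.2 hu0
  have ht : 0 < ‖v‖ := norm_pos_iff.2 hv0
  have hsec := mul_sub_le_rpow_sub_rpow (q := p - 1) (s := ‖u‖) (t := ‖v‖) (by linarith)
    (by linarith) hs ht.le
  have e1 : ∀ t : ℝ, 0 < t → t ^ (p - 1) = t ^ (p - 2) * t := fun t ht => by
    rw [← Real.rpow_add_one ht.ne']; congr 1; ring
  rw [e1 _ hs, e1 _ ht, show p - 1 - 1 = p - 2 by ring] at hsec
  have hR : (p - 1) * R ^ (p - 2) ≤ (p - 1) * ‖u‖ ^ (p - 2) :=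
    mul_le_mul_of_nonneg_left (Real.rpow_le_rpow_of_nonpos hs hu (by linarith)) (by linarith)
  have hc := real_inner_le_norm u v
  rw [norm_sub_sq_real]
  simp only [inner_sub_left, inner_sub_right, real_inner_smul_left, real_inner_self_eq_norm_sq,
    real_inner_comm u v]
  generalize (p - 1) * R ^ (p - 2) = k at *
  have hsec' : k * (‖u‖ - ‖v‖) ^ 2 ≤
      (‖u‖ ^ (p - 2) * ‖u‖ - ‖v‖ ^ (p - 2) * ‖v‖) * (‖u‖ - ‖v‖) := by
    have h0 : 0 ≤ ‖u‖ - ‖v‖ := sub_nonneg.2 hvu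
    have := mul_le_mul_of_nonneg_right hsec h0
    have := mul_le_mul_of_nonneg_right hR (mul_nonneg h0 h0)
    nlinarith
  have := mul_le_mul_of_nonneg_left hc
    (show 0 ≤ ‖u‖ ^ (p - 2) + ‖v‖ ^ (p - 2) - 2 * k by linarith)
  nlinarith

/-- The gradient of `‖·‖ ^ p / p`, `p ∈ (1, 2]`, is Hölder continuous of exponent `p - 1`. -/
lemma norm_rpow_smul_sub_le {p : ℝ} (hp1 : 1 < p) (hp2 : p ≤ 2) (u v : E) :
    ‖‖u‖ ^ (p - 2) • u - ‖v‖ ^ (p - 2) • v‖ ≤ 2 ^ (2 - p) * ‖u - v‖ ^ (p - 1) := by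
  wlog hvu : ‖v‖ ≤ ‖u‖ generalizing u v
  · rw [norm_sub_rev, norm_sub_rev u]
    exact this v u (le_of_not_ge hvu)
  have hq : 0 < p - 1 := by linarith
  have hq1 : p - 1 ≤ 1 := by linarith
  have hone : (1 : ℝ) ≤ 2 ^ (2 - p) := Real.one_le_rpow (by norm_num) (by linarith)
  have e1 : ∀ w : E, ‖w‖ ^ (p - 2) * ‖w‖ = ‖w‖ ^ (p - 1) := fun w => by
    rcases eq_or_ne w 0 with rfl | hw
    · simp [Real.zero_rpow hq.ne']
    · rw [← Real.rpow_add_one (norm_ne_zero_iff.2 hw)]; congr 1; ring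
  by_cases hv0 : v = 0
  · subst hv0
    rw [smul_zero, sub_zero, sub_zero, norm_smul, Real.norm_of_nonneg (by positivity), e1]
    exact le_mul_of_one_le_left (by positivity) hone
  have ht : 0 < ‖v‖ := norm_pos_iff.2 hv0
  have hs : 0 < ‖u‖ := ht.trans_le hvu
  set s := ‖u‖ with hsdef
  set t := ‖v‖ with htdef
  have hst : 0 < s * t := mul_pos hs ht
  -- the extreme cases of parallel and antiparallel vectors
  have hpar : s ^ (p - 1) - t ^ (p - 1) ≤ 2 ^ (2 - p) * (s - t) ^ (p - 1) := by
    have h := Real.rpow_add_le_add_rpow (sub_nonneg.2 hvu) ht.le hq.le hq1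
    rw [sub_add_cancel] at h
    have h0 : 0 ≤ (s - t) ^ (p - 1) := Real.rpow_nonneg (sub_nonneg.2 hvu) _
    nlinarith
  have hanti : s ^ (p - 1) + t ^ (p - 1) ≤ 2 ^ (2 - p) * (s + t) ^ (p - 1) := by
    have h := (Real.concaveOn_rpow hq.le hq1).2 (Set.mem_Ici.2 hs.le) (Set.mem_Ici.2 ht.le)
      (show (0 : ℝ) ≤ 1 / 2 by norm_num) (show (0 : ℝ) ≤ 1 / 2 by norm_num) (by norm_num)
    simp only [smul_eq_mul] at h
    rw [show 1 / 2 * s + 1 / 2 * t = (s + t) / 2 by ring,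
      Real.div_rpow (by positivity) (by norm_num)] at h
    have e : (2 : ℝ) ^ (2 - p) = 2 / 2 ^ (p - 1) := by
      rw [show 2 - p = 1 - (p - 1) by ring, Real.rpow_sub (by norm_num), Real.rpow_one]
    rw [e, div_mul_eq_mul_div, mul_div_assoc]
    linarith
  -- interpolate in the inner product
  obtain ⟨hc1, hc2⟩ := abs_le.1 (abs_real_inner_le_norm u v)
  rw [← hsdef, ← htdef] at hc1 hc2
  set c := ⟪u, v⟫ with hcdef
  set a := (s * t + c) / (2 * (s * t)) with ha
  set b := (s * t - c) / (2 * (s * t)) with hb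
  have ha0 : 0 ≤ a := div_nonneg (by linarith) (by positivity)
  have hb0 : 0 ≤ b := div_nonneg (by linarith) (by positivity)
  have hab : a + b = 1 := by rw [ha, hb]; field_simp; ring
  have hc : c = (a - b) * (s * t) := by rw [ha, hb]; field_simp; ring
  have hconc := (Real.concaveOn_rpow hq.le hq1).2
    (Set.mem_Ici.2 (sq_nonneg (s - t))) (Set.mem_Ici.2 (sq_nonneg (s + t))) ha0 hb0 hab
  have hsq : ∀ y : ℝ, 0 ≤ y → (y ^ 2) ^ (p - 1) = (y ^ (p - 1)) ^ 2 := fun y hy => by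
    rw [← Real.rpow_natCast, ← Real.rpow_natCast, ← Real.rpow_mul hy, ← Real.rpow_mul hy, mul_comm]
  have hnorm : a * (s - t) ^ 2 + b * (s + t) ^ 2 = ‖u - v‖ ^ 2 := by
    rw [norm_sub_sq_real, ← hsdef, ← htdef, ← hcdef, hc]
    linear_combination (s ^ 2 + t ^ 2) * hab
  simp only [smul_eq_mul] at hconc
  rw [hnorm, hsq _ (norm_nonneg _), hsq _ (sub_nonneg.2 hvu), hsq _ (by positivity)] at hconc
  have hlhs : ‖s ^ (p - 2) • u - t ^ (p - 2) • v‖ ^ 2 =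
      a * (s ^ (p - 1) - t ^ (p - 1)) ^ 2 + b * (s ^ (p - 1) + t ^ (p - 1)) ^ 2 := by
    rw [norm_sub_sq_real, norm_smul, norm_smul, Real.norm_of_nonneg (by positivity),
      Real.norm_of_nonneg (by positivity), real_inner_smul_left, real_inner_smul_right,
      ← hcdef, hc, ← e1 u, ← e1 v, ← hsdef, ← htdef]
    linear_combination
      (-(s ^ (p - 2) * s) ^ 2 - (t ^ (p - 2) * t) ^ 2) * hab
  have hpar2 := pow_le_pow_left₀
    (sub_nonneg.2 (Real.rpow_le_rpow ht.le hvu hq.le)) hpar 2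
  have hanti2 := pow_le_pow_left₀ (by positivity) hanti 2
  refine le_of_sq_le_sq ?_ (by positivity)
  rw [hlhs]
  have h1 := mul_le_mul_of_nonneg_left hpar2 ha0
  have h2 := mul_le_mul_of_nonneg_left hanti2 hb0
  have h3 := mul_le_mul_of_nonneg_left hconc (sq_nonneg ((2 : ℝ) ^ (2 - p)))
  nlinarith

end PowerMap

/-- First-order optimality of a minimizer of `frechetFun` over a convex set. -/
lemma frechetFun_first_order {m n : ℕ} {p : ℝ} (hn : 0 < n) (hp1 : 1 < p)
    {x : Fin n → EuclideanSpace ℝ (Fin m)} {S : Set (EuclideanSpace ℝ (Fin m))}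
    (hS : Convex ℝ S) {y z : EuclideanSpace ℝ (Fin m)} (hy : y ∈ S) (hz : z ∈ S)
    (hmin : IsMinOn (frechetFun p x) S y) :
    0 ≤ ∑ i, ⟪‖y - x i‖ ^ (p - 2) • (y - x i), z - y⟫ := by
  have hd : HasFDerivAt (frechetFun p x) ((1 / (n * p)) • ∑ i : Fin n,
      (p * ‖y - x i‖ ^ (p - 2)) • innerSL ℝ (y - x i)) y := by
    refine HasFDerivAt.const_mul (HasFDerivAt.fun_sum fun i _ => ?_) _
    exact (hasFDerivAt_norm_rpow (y - x i) hp1).comp y ((hasFDerivAt_id y).sub_const (x i))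
  have h := hmin.localize.hasFDerivWithinAt_nonneg hd.hasFDerivWithinAt
    (sub_mem_posTangentConeAt_of_segment_subset (hS.segment_subset hy hz))
  have hn' : (0 : ℝ) < n := Nat.cast_pos.2 hn
  have e : ((1 / (n * p)) • ∑ i : Fin n,
      (p * ‖y - x i‖ ^ (p - 2)) • innerSL ℝ (y - x i)) (z - y) =
      1 / n * ∑ i, ⟪‖y - x i‖ ^ (p - 2) • (y - x i), z - y⟫ := by
    simp only [smul_apply, sum_apply, innerSL_apply_apply,
      smul_eq_mul, real_inner_smul_left, Finset.mul_sum]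
    refine Finset.sum_congr rfl fun i _ => ?_
    field_simp
  rw [e] at h
  exact nonneg_of_mul_nonneg_right h (by positivity)

/-- Sensitivity of the generalized Fréchet mean for `p ∈ (1, 2]` (Theorem 4.8,
flat case): if `μ` and `μ′` are the minimizers over `B̄(o, r)` of the empirical
Fréchet `p`-functionals of adjacent datasets in `B̄(o, r)`, then
`‖μ − μ′‖ ≤ (2r)^{p−1} / (n (4r)^{p−2} (p − 1))`. -/
theorem frechet_mean_sensitivity_p_le_two
    (m n : ℕ) (hm : 1 ≤ m) (hn : 0 < n) (p r : ℝ) (hp1 : 1 < p) (hp2 : p ≤ 2)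
    (hr : 0 < r) (o : EuclideanSpace ℝ (Fin m))
    (x x' : Fin n → EuclideanSpace ℝ (Fin m))
    (hx : ∀ i, x i ∈ Metric.closedBall o r)
    (hx' : ∀ i, x' i ∈ Metric.closedBall o r)
    (hadj : ∃ j : Fin n, ∀ i : Fin n, i ≠ j → x i = x' i)
    (μ μ' : EuclideanSpace ℝ (Fin m))
    (hμ : μ ∈ Metric.closedBall o r ∧
      ∀ z ∈ Metric.closedBall o r, frechetFun p x μ ≤ frechetFun p x z)
    (hμ' : μ' ∈ Metric.closedBall o r ∧
      ∀ z ∈ Metric.closedBall o r, frechetFun p x' μ' ≤ frechetFun p x' z) :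
    ‖μ - μ'‖ ≤ (2 * r) ^ (p - 1) / (n * (4 * r) ^ (p - 2) * (p - 1)) := by
  obtain ⟨j, hj⟩ := hadj
  have hn' : (0 : ℝ) < n := Nat.cast_pos.2 hn
  have hdist : ∀ y ∈ Metric.closedBall o r, ∀ z ∈ Metric.closedBall o r, ‖y - z‖ ≤ 2 * r := by
    intro y hy z hz
    rw [← dist_eq_norm]
    have := dist_triangle_right y z o
    rw [Metric.mem_closedBall] at hy hz
    linarith
  have hopt := frechetFun_first_order hn hp1 (convex_closedBall o r) hμ.1 hμ'.1 hμ.2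
  have hopt' := frechetFun_first_order hn hp1 (convex_closedBall o r) hμ'.1 hμ.1 hμ'.2
  have hmono : (n : ℝ) * ((p - 1) * (2 * r) ^ (p - 2) * ‖μ - μ'‖ ^ 2) ≤
      ∑ i, ⟪‖μ - x i‖ ^ (p - 2) • (μ - x i) - ‖μ' - x i‖ ^ (p - 2) • (μ' - x i), μ - μ'⟫ := by
    have h := Finset.sum_le_sum fun i (_ : i ∈ Finset.univ) =>
      mul_norm_sub_sq_le_inner_rpow_smul_sub hp1 hp2
        (hdist μ hμ.1 (x i) (hx i)) (hdist μ' hμ'.1 (x i) (hx i))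
    simpa only [sub_sub_sub_cancel_right, Finset.sum_const, Finset.card_univ, Fintype.card_fin,
      nsmul_eq_mul] using h
  have hswap : ∑ i, ⟪‖μ' - x' i‖ ^ (p - 2) • (μ' - x' i) - ‖μ' - x i‖ ^ (p - 2) • (μ' - x i),
      μ - μ'⟫ ≤ 2 ^ (2 - p) * (2 * r) ^ (p - 1) * ‖μ - μ'‖ := by
    rw [Finset.sum_eq_single j (fun i _ hi => by rw [hj i hi, sub_self, inner_zero_left])
      (fun h => absurd (Finset.mem_univ j) h)]
    refine (real_inner_le_norm _ _).trans (mul_le_mul_of_nonneg_right ?_ (norm_nonneg _))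
    refine (norm_rpow_smul_sub_le hp1 hp2 _ _).trans ?_
    rw [sub_sub_sub_cancel_left]
    have := hdist (x j) (hx j) (x' j) (hx' j)
    have hp : 0 ≤ p - 1 := by linarith
    gcongr
  rw [← neg_sub μ μ'] at hopt
  simp only [inner_sub_left, inner_neg_right, Finset.sum_sub_distrib, Finset.sum_neg_distrib]
    at hopt hopt' hmono hswap
  have hmain : (n : ℝ) * ((p - 1) * (2 * r) ^ (p - 2) * ‖μ - μ'‖ ^ 2) ≤
      2 ^ (2 - p) * (2 * r) ^ (p - 1) * ‖μ - μ'‖ := by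
    linarith
  have h4 : (4 * r) ^ (p - 2) = (2 * r) ^ (p - 2) / 2 ^ (2 - p) := by
    rw [show 4 * r = 2 * r * 2 by ring, Real.mul_rpow (by positivity) (by norm_num),
      show p - 2 = -(2 - p) by ring, Real.rpow_neg (x := 2) (by norm_num), div_eq_mul_inv]
  have hp : 0 < p - 1 := by linarith
  rw [h4, le_div_iff₀ (by positivity)]
  rcases (norm_nonneg (μ - μ')).eq_or_lt with h0 | h0
  · rw [← h0, zero_mul]
    positivity
  have h2 : (0 : ℝ) < 2 ^ (2 - p) := by positivity
  have hcancel : ‖μ - μ'‖ * (n * (2 * r) ^ (p - 2) * (p - 1)) ≤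
      2 ^ (2 - p) * (2 * r) ^ (p - 1) := by
    refine le_of_mul_le_mul_right ?_ h0
    linarith
  calc ‖μ - μ'‖ * (n * ((2 * r) ^ (p - 2) / 2 ^ (2 - p)) * (p - 1))
      = ‖μ - μ'‖ * (n * (2 * r) ^ (p - 2) * (p - 1)) / 2 ^ (2 - p) := by ring
    _ ≤ (2 * r) ^ (p - 1) := by
      rw [div_le_iff₀ h2]
      linarith
end

section
/- Let m ≥ 1, p > 2, r > 0, o ∈ ℝ^m, set λ_p = 8/(p·2^p), and let D and D′ be adjacent datasets of n points in the closed ball B̄(o, r) (differing in at most one entry). Let μ_p(D) and μ_p(D′) be the unique minimizers of the empirical Fréchet p-functionals F_D and F_{D′} over B̄(o, r). Then ‖μ_p(D) − μ_p(D′)‖ ≤ ( (p − 1)·(4r)^{p−2}·2r / (n·λ_p) )^{1/(p−1)}. -/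
/-- A homogeneous form of Bernoulli's inequality. -/
lemma mul_rpow_sub_rpow_le (q : ℝ) (hq : 0 ≤ q) {s t : ℝ} (ht : 0 ≤ t) (hts : t ≤ s) :
    t * (s ^ q - t ^ q) ≤ q * s ^ q * (s - t) := by
  rcases (ht.trans hts).eq_or_lt with rfl | hs
  · obtain rfl : t = 0 := le_antisymm hts ht
    simp
  have hb := one_add_mul_self_le_rpow_one_add (s := t / s - 1)
    (by have := div_nonneg ht hs.le; linarith) (p := q + 1) (by linarith)
  rw [add_sub_cancel, Real.div_rpow ht hs.le, Real.rpow_add_one' ht (by linarith),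
    Real.rpow_add_one hs.ne'] at hb
  have hsq : 0 < s ^ q := Real.rpow_pos_of_pos hs q
  have h := mul_le_mul_of_nonneg_left hb (mul_pos hsq hs).le
  rw [mul_div_cancel₀ _ (mul_pos hsq hs).ne'] at h
  have h' : s ^ q * s * (1 + (q + 1) * (t / s - 1)) = s ^ q * (s + (q + 1) * (t - s)) := by
    field_simp
  rw [h'] at h
  linarith

/-- The scalar inequality behind uniform monotonicity of the gradient of a power of the norm. -/
lemma half_rpow_mul_sq_le (q : ℝ) (hq : 0 ≤ q) {s t d : ℝ} (hs : 0 ≤ s) (ht : 0 ≤ t) (hd : 0 ≤ d)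
    (hdst : d ≤ s + t) :
    (d / 2) ^ q * d ^ 2
      ≤ (s ^ q + t ^ q) / 2 * d ^ 2 + (s ^ q - t ^ q) * (s ^ 2 - t ^ 2) / 2 := by
  rcases (add_nonneg hs ht).eq_or_lt with hst | hst
  · obtain rfl : d = 0 := by linarith
    obtain rfl : s = 0 := by linarith
    obtain rfl : t = 0 := by linarith
    simp
  have hmean : ((s + t) / 2) ^ q * (s + t) ≤ s ^ q * s + t ^ q * t := by
    have h := (convexOn_rpow (p := q + 1) (by linarith)).2 hs ht
      (by norm_num : (0 : ℝ) ≤ 1 / 2) (by norm_num : (0 : ℝ) ≤ 1 / 2) (by norm_num)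
    simp only [smul_eq_mul] at h
    rw [show 1 / 2 * s + 1 / 2 * t = (s + t) / 2 by ring, Real.rpow_add_one (by positivity),
      Real.rpow_add_one' hs (by linarith), Real.rpow_add_one' ht (by linarith)] at h
    linarith
  have hmono : (d / 2) ^ q ≤ ((s + t) / 2) ^ q := by gcongr
  have hsign : 0 ≤ (s ^ q - t ^ q) * (s - t) := by
    rcases le_total s t with h | h
    · exact mul_nonneg_of_nonpos_of_nonpos
        (sub_nonpos.2 (Real.rpow_le_rpow hs h hq)) (sub_nonpos.2 h)
    · exact mul_nonneg (sub_nonneg.2 (Real.rpow_le_rpow ht h hq)) (sub_nonneg.2 h)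
  refine le_of_mul_le_mul_left ?_ hst
  have hsq : d ^ 2 ≤ (s + t) ^ 2 := by gcongr
  have h₁ := mul_le_mul_of_nonneg_left hmono (mul_nonneg hst.le (sq_nonneg d))
  have h₂ := mul_le_mul_of_nonneg_left hmean (sq_nonneg d)
  have h₃ := mul_le_mul_of_nonneg_left hsq hsign
  linarith

section NormRpowGradient

variable {E : Type*} [NormedAddCommGroup E] [InnerProductSpace ℝ E]

/-- The field `u ↦ ‖u‖ ^ q • u`, i.e. the gradient of `‖·‖ ^ (q + 2) / (q + 2)`, is uniformly
monotone with constant `2 ^ (-q)`. -/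
lemma norm_sub_rpow_mul_sq_le_inner (q : ℝ) (hq : 0 ≤ q) (a b : E) :
    (‖a - b‖ / 2) ^ q * ‖a - b‖ ^ 2 ≤ inner ℝ (‖a‖ ^ q • a - ‖b‖ ^ q • b) (a - b) := by
  have hD : ‖a - b‖ ^ 2 = ‖a‖ ^ 2 - 2 * inner ℝ a b + ‖b‖ ^ 2 := norm_sub_sq_real a b
  have hinner : inner ℝ (‖a‖ ^ q • a - ‖b‖ ^ q • b) (a - b)
      = (‖a‖ ^ q + ‖b‖ ^ q) / 2 * ‖a - b‖ ^ 2
        + (‖a‖ ^ q - ‖b‖ ^ q) * (‖a‖ ^ 2 - ‖b‖ ^ 2) / 2 := by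
    simp only [inner_sub_left, inner_sub_right, real_inner_smul_left,
      real_inner_self_eq_norm_sq, real_inner_comm a b, hD]
    ring
  rw [hinner]
  have htri : ‖a - b‖ ≤ ‖a‖ + ‖b‖ := norm_sub_le a b
  exact half_rpow_mul_sq_le q hq (norm_nonneg a) (norm_nonneg b) (norm_nonneg _) htri

/-- On the ball of radius `R` the field `u ↦ ‖u‖ ^ q • u` is Lipschitz with constant
`(q + 1) * R ^ q`. -/
lemma norm_rpow_smul_sub_le_s18 (q R : ℝ) (hq : 0 ≤ q) (u v : E) (hu : ‖u‖ ≤ R) (hv : ‖v‖ ≤ R) :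
    ‖‖u‖ ^ q • u - ‖v‖ ^ q • v‖ ≤ (q + 1) * R ^ q * ‖u - v‖ := by
  wlog h : ‖v‖ ≤ ‖u‖ generalizing u v
  · rw [norm_sub_rev, norm_sub_rev u v]
    exact this v u hv hu (le_of_not_ge h)
  have hbern : ‖v‖ * (‖u‖ ^ q - ‖v‖ ^ q) ≤ q * ‖u‖ ^ q * (‖u‖ - ‖v‖) :=
    mul_rpow_sub_rpow_le q hq (norm_nonneg v) h
  have hpow : ‖v‖ ^ q ≤ ‖u‖ ^ q := Real.rpow_le_rpow (norm_nonneg v) h hq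
  have hR : ‖u‖ ^ q ≤ R ^ q := Real.rpow_le_rpow (norm_nonneg u) hu hq
  have hu0 : 0 ≤ ‖u‖ ^ q := by positivity
  calc ‖‖u‖ ^ q • u - ‖v‖ ^ q • v‖
      = ‖‖u‖ ^ q • (u - v) + (‖u‖ ^ q - ‖v‖ ^ q) • v‖ := by
        congr 1; module
    _ ≤ ‖u‖ ^ q * ‖u - v‖ + (‖u‖ ^ q - ‖v‖ ^ q) * ‖v‖ := by
        refine (norm_add_le _ _).trans_eq ?_
        rw [norm_smul, norm_smul, Real.norm_of_nonneg hu0, Real.norm_of_nonneg (sub_nonneg.2 hpow)]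
    _ ≤ ‖u‖ ^ q * ‖u - v‖ + q * ‖u‖ ^ q * ‖u - v‖ := by
        have := mul_le_mul_of_nonneg_left (norm_sub_norm_le u v) (mul_nonneg hq hu0)
        linarith
    _ = (q + 1) * ‖u‖ ^ q * ‖u - v‖ := by ring
    _ ≤ (q + 1) * R ^ q * ‖u - v‖ := by gcongr

/-- First-order optimality of a constrained minimizer of `y ↦ ∑ i, ‖y - x i‖ ^ p`. -/
lemma sum_inner_nonneg_of_isMinOn {ι : Type*} [Fintype ι] {p : ℝ} (hp : 1 < p) {s : Set E}
    (hs : Convex ℝ s) (x : ι → E) {y z : E} (hy : y ∈ s) (hz : z ∈ s)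
    (hmin : IsMinOn (fun w => ∑ i, ‖w - x i‖ ^ p) s y) :
    0 ≤ ∑ i, inner ℝ (‖y - x i‖ ^ (p - 2) • (y - x i)) (z - y) := by
  have hderiv : HasFDerivAt (fun w => ∑ i, ‖w - x i‖ ^ p)
      (∑ i, (p * ‖y - x i‖ ^ (p - 2)) • innerSL ℝ (y - x i)) y := by
    refine HasFDerivAt.fun_sum fun i _ => ?_
    simpa [Function.comp_def] using (hasFDerivAt_norm_rpow (y - x i) hp).comp y
      ((hasFDerivAt_id y).sub_const (x i))
  have h := hmin.localize.hasFDerivWithinAt_nonneg hderiv.hasFDerivWithinAt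
    (sub_mem_posTangentConeAt_of_segment_subset (hs.segment_subset hy hz))
  simp only [sum_apply, smul_apply, innerSL_apply_apply,
    smul_eq_mul, mul_assoc] at h
  rw [← Finset.mul_sum] at h
  simpa only [real_inner_smul_left] using nonneg_of_mul_nonneg_right h (by linarith)

end NormRpowGradient

lemma isMinOn_sum_of_frechetFun_le {m n : ℕ} (hn : 0 < n) {p : ℝ} (hp : 0 < p)
    {x : Fin n → EuclideanSpace ℝ (Fin m)} {s : Set (EuclideanSpace ℝ (Fin m))}
    {y : EuclideanSpace ℝ (Fin m)} (h : ∀ z ∈ s, frechetFun p x y ≤ frechetFun p x z) :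
    IsMinOn (fun w => ∑ i, ‖w - x i‖ ^ p) s y := by
  intro z hz
  have hn' : (0 : ℝ) < n := by exact_mod_cast hn
  exact le_of_mul_le_mul_left (h z hz) (by positivity)

/-- Sensitivity of the generalized Fréchet mean for `p > 2` (Theorem 4.10
specialized to `ℝ^m`, with NSK constant `λ_p = 8/(p·2^p)`): if `μ` and `μ′` are
the minimizers over `B̄(o, r)` of the empirical Fréchet `p`-functionals of
adjacent datasets in `B̄(o, r)`, then
`‖μ − μ′‖ ≤ ((p − 1)(4r)^{p−2}·2r / (n·λ_p))^{1/(p−1)}`. -/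
theorem frechet_mean_sensitivity_p_gt_two
    (m n : ℕ) (hm : 1 ≤ m) (hn : 0 < n) (p r : ℝ) (hp : 2 < p) (hr : 0 < r)
    (o : EuclideanSpace ℝ (Fin m))
    (x x' : Fin n → EuclideanSpace ℝ (Fin m))
    (hx : ∀ i, x i ∈ Metric.closedBall o r)
    (hx' : ∀ i, x' i ∈ Metric.closedBall o r)
    (hadj : ∃ j : Fin n, ∀ i : Fin n, i ≠ j → x i = x' i)
    (μ μ' : EuclideanSpace ℝ (Fin m))
    (hμ : μ ∈ Metric.closedBall o r ∧
      ∀ z ∈ Metric.closedBall o r, frechetFun p x μ ≤ frechetFun p x z)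
    (hμ' : μ' ∈ Metric.closedBall o r ∧
      ∀ z ∈ Metric.closedBall o r, frechetFun p x' μ' ≤ frechetFun p x' z) :
    ‖μ - μ'‖ ≤ ((p - 1) * (4 * r) ^ (p - 2) * (2 * r) / (n * (8 / (p * 2 ^ p))))
      ^ (1 / (p - 1)) := by
  obtain ⟨j, hj⟩ := hadj
  have hn' : (0 : ℝ) < n := by exact_mod_cast hn
  have hq : 0 ≤ p - 2 := by linarith
  have hdist : ∀ y ∈ Metric.closedBall o r, ∀ z ∈ Metric.closedBall o r, ‖y - z‖ ≤ 2 * r := by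
    intro y hy z hz
    rw [← dist_eq_norm]
    have := dist_triangle_right y z o
    rw [Metric.mem_closedBall] at hy hz
    linarith
  set A : EuclideanSpace ℝ (Fin m) → EuclideanSpace ℝ (Fin m) :=
    fun u => ‖u‖ ^ (p - 2) • u
  have hopt : 0 ≤ ∑ i, inner ℝ (A (μ - x i)) (μ' - μ) :=
    sum_inner_nonneg_of_isMinOn (by linarith) (convex_closedBall o r) x hμ.1 hμ'.1
      (isMinOn_sum_of_frechetFun_le hn (by linarith) hμ.2)
  have hopt' : 0 ≤ ∑ i, inner ℝ (A (μ' - x' i)) (μ - μ') :=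
    sum_inner_nonneg_of_isMinOn (by linarith) (convex_closedBall o r) x' hμ'.1 hμ.1
      (isMinOn_sum_of_frechetFun_le hn (by linarith) hμ'.2)
  have hmono : n * ((‖μ - μ'‖ / 2) ^ (p - 2) * ‖μ - μ'‖ ^ 2)
      ≤ ∑ i, inner ℝ (A (μ - x i) - A (μ' - x i)) (μ - μ') := by
    have h : ∀ i ∈ Finset.univ, (‖μ - μ'‖ / 2) ^ (p - 2) * ‖μ - μ'‖ ^ 2
        ≤ inner ℝ (A (μ - x i) - A (μ' - x i)) (μ - μ') := fun i _ => by
      simpa only [sub_sub_sub_cancel_right] using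
        norm_sub_rpow_mul_sq_le_inner (p - 2) hq (μ - x i) (μ' - x i)
    simpa using Finset.card_nsmul_le_sum _ _ _ h
  have hreplace : ∑ i, inner ℝ (A (μ' - x' i) - A (μ' - x i)) (μ - μ')
      = inner ℝ (A (μ' - x' j) - A (μ' - x j)) (μ - μ') := by
    refine Finset.sum_eq_single j (fun i _ hi => ?_) (by simp)
    rw [hj i hi, sub_self, inner_zero_left]
  have hsum : ∑ i, inner ℝ (A (μ - x i) - A (μ' - x i)) (μ - μ')
      ≤ ∑ i, inner ℝ (A (μ' - x' i) - A (μ' - x i)) (μ - μ') := by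
    rw [← neg_sub μ μ'] at hopt
    simp only [inner_sub_left, inner_neg_right, Finset.sum_sub_distrib,
      Finset.sum_neg_distrib] at hopt hopt' ⊢
    linarith
  have hlip : ‖A (μ' - x' j) - A (μ' - x j)‖ ≤ (p - 1) * (2 * r) ^ (p - 2) * (2 * r) := by
    refine (norm_rpow_smul_sub_le_s18 (p - 2) (2 * r) hq _ _ (hdist _ hμ'.1 _ (hx' j))
      (hdist _ hμ'.1 _ (hx j))).trans ?_
    rw [sub_sub_sub_cancel_left, show p - 2 + 1 = p - 1 by ring]
    exact mul_le_mul_of_nonneg_left (hdist _ (hx j) _ (hx' j))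
      (mul_nonneg (by linarith) (by positivity))
  have hkey : n * ((‖μ - μ'‖ / 2) ^ (p - 2) * ‖μ - μ'‖ ^ 2)
      ≤ (p - 1) * (2 * r) ^ (p - 2) * (2 * r) * ‖μ - μ'‖ :=
    (hmono.trans (hsum.trans_eq hreplace)).trans <| (real_inner_le_norm _ _).trans <|
      mul_le_mul_of_nonneg_right hlip (norm_nonneg _)
  have hnum : 0 ≤ (p - 1) * (4 * r) ^ (p - 2) * (2 * r) :=
    mul_nonneg (mul_nonneg (by linarith) (by positivity)) (by positivity)
  have hbase : ‖μ - μ'‖ ^ (p - 1) ≤ (p - 1) * (4 * r) ^ (p - 2) * (2 * r) / n := by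
    rcases (norm_nonneg (μ - μ')).eq_or_lt with h0 | hpos
    · rw [← h0, Real.zero_rpow (by linarith)]
      positivity
    generalize ‖μ - μ'‖ = d at hkey hpos
    rw [le_div_iff₀ hn', show p - 1 = (p - 2) + 1 by ring, Real.rpow_add_one hpos.ne',
      show d = 2 * (d / 2) by ring, show 4 * r = 2 * (2 * r) by ring,
      Real.mul_rpow two_pos.le (by positivity), Real.mul_rpow two_pos.le (by positivity),
      show 2 * (d / 2) = d by ring]
    have h : n * ((d / 2) ^ (p - 2) * d) ≤ (p - 1) * (2 * r) ^ (p - 2) * (2 * r) :=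
      le_of_mul_le_mul_right (by linarith) hpos
    have := mul_le_mul_of_nonneg_left h (Real.rpow_nonneg two_pos.le (p - 2))
    linarith
  have hconst : 8 / (p * 2 ^ p) ≤ 1 := by
    have h4 : (4 : ℝ) ≤ 2 ^ p := by
      have := Real.rpow_le_rpow_of_exponent_le (one_le_two : (1 : ℝ) ≤ 2) hp.le
      norm_num at this
      exact this
    rw [div_le_one (by positivity)]
    nlinarith
  rw [one_div, Real.le_rpow_inv_iff_of_pos (norm_nonneg _) (by positivity) (by linarith)]
  refine hbase.trans (div_le_div_of_nonneg_left hnum (by positivity) ?_)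
  exact mul_le_of_le_one_right hn'.le hconst
end
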